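/- Let σ ≥ 2 and let w satisfy 1 ≤ w ≤ min{10, k−1}. Then Dev_σ(k,w+1) − Dev_σ(k,w) > 0. -/

import Mathlib

open Finset

/-- The `i`-th length-`k` substring (`k`-mer) of a word of length `w + k`
over the alphabet `Fin σ`. -/
def kmerAt (σ k w : ℕ) (v : Fin (w + k) → Fin σ) (i : Fin (w + 1)) : Fin k → Fin σ :=
  fun j => v ⟨i.1 + j.1, by have h1 := i.2; have h2 := j.2; omega⟩

/-- `v` is a gamechanger with respect to the linear order (ranking) `ρ` on `k`-mers:
either its `k`-prefix is a `ρ`-minimal `k`-mer of `v`, or its `k`-suffix is a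
`ρ`-minimal `k`-mer of `v` occurring exactly once in `v`. -/
def IsGC (σ k w : ℕ) (ρ : (Fin k → Fin σ) ≃ Fin (σ ^ k)) (v : Fin (w + k) → Fin σ) : Prop :=
  (∀ i : Fin (w + 1), ρ (kmerAt σ k w v 0) ≤ ρ (kmerAt σ k w v i)) ∨
  ((∀ i : Fin (w + 1), ρ (kmerAt σ k w v (Fin.last w)) ≤ ρ (kmerAt σ k w v i)) ∧
    (∀ i : Fin (w + 1), kmerAt σ k w v i = kmerAt σ k w v (Fin.last w) → i = Fin.last w))

/-- `P_{σ,k}(v)`: the fraction of linear orders `ρ` on `σ`-ary `k`-strings for which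
`v` is a gamechanger. -/
noncomputable def Pgc (σ k w : ℕ) (v : Fin (w + k) → Fin σ) : ℝ :=
  (Nat.card {ρ : (Fin k → Fin σ) ≃ Fin (σ ^ k) // IsGC σ k w ρ v} : ℝ) /
    (Nat.card ((Fin k → Fin σ) ≃ Fin (σ ^ k)) : ℝ)

/-- `D_ρ`: the fraction of gamechangers among all `σ`-ary strings of length `w + k`. -/
noncomputable def Dens (σ k w : ℕ) (ρ : (Fin k → Fin σ) ≃ Fin (σ ^ k)) : ℝ :=
  (Nat.card {v : Fin (w + k) → Fin σ // IsGC σ k w ρ v} : ℝ) / ((σ : ℝ) ^ (w + k))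

/-- `DR_σ(k,w)`: the expected density, i.e. the average of `D_ρ` over all orders `ρ`. -/
noncomputable def DR (σ k w : ℕ) : ℝ :=
  (∑ ρ : (Fin k → Fin σ) ≃ Fin (σ ^ k), Dens σ k w ρ) /
    (Nat.card ((Fin k → Fin σ) ≃ Fin (σ ^ k)) : ℝ)

/-- `DFR_σ(k,w) = (w+1) · DR_σ(k,w)`, the expected density factor. -/
noncomputable def DFR (σ k w : ℕ) : ℝ := ((w : ℝ) + 1) * DR σ k w

/-- The number of distinct `k`-mers of `v`. -/
def numKmers (σ k w : ℕ) (v : Fin (w + k) → Fin σ) : ℕ :=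
  (Finset.univ.image (kmerAt σ k w v)).card

/-- `Rep_{σ,k,w}`: the set of `σ`-ary strings of length `w + k` that contain two equal
`k`-substrings at distinct positions. -/
def RepSet (σ k w : ℕ) : Finset (Fin (w + k) → Fin σ) :=
  Finset.univ.filter fun v =>
    ∃ i j : Fin (w + 1), i ≠ j ∧ kmerAt σ k w v i = kmerAt σ k w v j

/-- `Dev_σ(k,w)`, the deviation of the random order. -/
noncomputable def Dev (σ k w : ℕ) : ℝ :=
  (∑ v ∈ RepSet σ k w, Pgc σ k w v) - (2 / ((w : ℝ) + 1)) * ((RepSet σ k w).card : ℝ)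

/-- `p` is a period of the string `s` (of length `n`): `s[i] = s[i+p]` whenever both
positions are inside `s`. -/
def HasPeriod (σ n : ℕ) (s : Fin n → Fin σ) (p : ℕ) : Prop :=
  ∀ (i : ℕ) (h : i + p < n), s ⟨i, by omega⟩ = s ⟨i + p, h⟩

/-- A string is primitive if it is not of the form `u^m` with `m ≥ 2`, equivalently it
has no period that is a proper divisor of its length. -/
def IsPrimitive (σ n : ℕ) (s : Fin n → Fin σ) : Prop :=
  ¬ ∃ d, d ∣ n ∧ d < n ∧ HasPeriod σ n s d

/-- `Prim_σ(n)`: the number of primitive `σ`-ary strings of length `n`. -/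
noncomputable def Prim (σ n : ℕ) : ℕ :=
  Nat.card {s : Fin n → Fin σ // IsPrimitive σ n s}

/-- The substring of `v` of length `ℓ` starting at (0-indexed) position `i`. -/
def subAt (σ n : ℕ) (v : Fin n → Fin σ) (i ℓ : ℕ) (h : i + ℓ ≤ n) : Fin ℓ → Fin σ :=
  fun j => v ⟨i + j.1, by have := j.2; omega⟩

/-- A string is `p`-periodic if `p` is its minimal period and `p ≤ |s|/2`. -/
def IsPPeriodic (σ n : ℕ) (s : Fin n → Fin σ) (p : ℕ) : Prop :=
  1 ≤ p ∧ 2 * p ≤ n ∧ HasPeriod σ n s p ∧ ∀ q, 1 ≤ q → q < p → ¬ HasPeriod σ n s q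

/-- The occurrence `v[i..i+ℓ)` is a run of period `p`: it is `p`-periodic and is not
contained in a longer `p`-periodic substring of `v`. -/
def IsRun (σ n : ℕ) (v : Fin n → Fin σ) (i ℓ p : ℕ) (h : i + ℓ ≤ n) : Prop :=
  IsPPeriodic σ ℓ (subAt σ n v i ℓ h) p ∧
    ∀ (i' ℓ' : ℕ) (h' : i' + ℓ' ≤ n), i' ≤ i → i + ℓ ≤ i' + ℓ' → ℓ < ℓ' →
      ¬ IsPPeriodic σ ℓ' (subAt σ n v i' ℓ' h') p

/-- A major run: a run `x` of period `p` with `|x| ≥ |v|/2 + p`. -/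
def IsMajorRun (σ n : ℕ) (v : Fin n → Fin σ) (i ℓ p : ℕ) (h : i + ℓ ≤ n) : Prop :=
  IsRun σ n v i ℓ p h ∧ n + 2 * p ≤ 2 * ℓ

section MinProb
open Classical in
lemma min_card {α : Type} [Fintype α] (N : ℕ) (S : Finset α) (x : α) (hx : x ∈ S) :
    (Nat.card {ρ : α ≃ Fin N // ∀ y ∈ S, ρ x ≤ ρ y}) * S.card = Nat.card (α ≃ Fin N) := by
  have heq : ∀ y ∈ S, Nat.card {ρ : α ≃ Fin N // ∀ z ∈ S, ρ y ≤ ρ z} =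
      Nat.card {ρ : α ≃ Fin N // ∀ z ∈ S, ρ x ≤ ρ z} := by
    intro y hy
    have hs : ∀ z ∈ S, Equiv.swap x y z ∈ S := by
      intro z hz
      rcases Equiv.swap_apply_def x y z with h
      rw [h]; split_ifs <;> assumption
    refine Nat.card_congr (Equiv.subtypeEquiv
      (Equiv.equivCongr (Equiv.swap x y) (Equiv.refl (Fin N))) ?_)
    intro ρ
    simp only [Equiv.equivCongr, Equiv.coe_fn_mk, Equiv.trans_apply, Equiv.symm_swap,
      Equiv.swap_apply_left, Equiv.refl_apply]
    constructor
    · intro h z hz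
      exact h _ (hs z hz)
    · intro h z hz
      have := h _ (hs z hz)
      simpa using this
  have hsum : ∑ y ∈ S, Nat.card {ρ : α ≃ Fin N // ∀ z ∈ S, ρ y ≤ ρ z} =
      Nat.card (α ≃ Fin N) := by
    simp only [Nat.card_eq_fintype_card, Fintype.card_subtype]
    rw [← Finset.card_univ, ← Finset.card_biUnion]
    · congr 1
      ext ρ
      simp only [mem_biUnion, mem_filter, mem_univ, true_and, iff_true]
      exact Finset.exists_min_image S ρ ⟨x, hx⟩
    · intro a ha b hb hab
      simp only [Function.onFun]
      rw [Finset.disjoint_left]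
      intro ρ h1 h2
      simp only [mem_filter, mem_univ, true_and] at h1 h2
      exact hab (ρ.injective (le_antisymm (h1 b hb) (h2 a ha)))
  rw [Finset.sum_congr rfl heq] at hsum
  simp at hsum
  rw [mul_comm]; simpa using hsum

/-- suffix repeated -/
def SufRep (σ k w : ℕ) (v : Fin (w + k) → Fin σ) : Prop :=
  ∃ i : Fin (w + 1), i ≠ Fin.last w ∧ kmerAt σ k w v i = kmerAt σ k w v (Fin.last w)

open Classical in
lemma Pgc_eq (σ k w : ℕ) (hw : 1 ≤ w) (v : Fin (w + k) → Fin σ) :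
    Pgc σ k w v = (if SufRep σ k w v then 1 else 2) / (numKmers σ k w v : ℝ) := by
  set S := Finset.univ.image (kmerAt σ k w v) with hS
  have hN : 0 < Nat.card ((Fin k → Fin σ) ≃ Fin (σ ^ k)) := by
    have : Nonempty ((Fin k → Fin σ) ≃ Fin (σ ^ k)) := 
      ⟨Fintype.equivFinOfCardEq (by simp)⟩
    exact Nat.card_pos
  have hd : 0 < S.card := by
    rw [Finset.card_pos]; exact ⟨kmerAt σ k w v 0, by simp [hS]⟩
  have hm : ∀ i, kmerAt σ k w v i ∈ S := by intro i; simp [hS]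
  have key : ∀ i : Fin (w+1), (Nat.card {ρ : (Fin k → Fin σ) ≃ Fin (σ ^ k) //
      ∀ j, ρ (kmerAt σ k w v i) ≤ ρ (kmerAt σ k w v j)}) * S.card =
        Nat.card ((Fin k → Fin σ) ≃ Fin (σ ^ k)) := by
    intro i
    rw [← min_card (σ ^ k) S (kmerAt σ k w v i) (hm i)]
    congr 1
    refine Nat.card_congr (Equiv.subtypeEquivRight ?_)
    intro ρ
    simp [hS]
  have k0 := key 0
  have kl := key (Fin.last w)
  have hnum : numKmers σ k w v = S.card := rfl
  rw [hnum]
  unfold Pgc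
  rw [div_eq_div_iff (by exact_mod_cast hN.ne') (by exact_mod_cast hd.ne')]
  split_ifs with h
  · obtain ⟨i, hi, hi'⟩ := h
    have : ∀ ρ, IsGC σ k w ρ v ↔ ∀ j, ρ (kmerAt σ k w v 0) ≤ ρ (kmerAt σ k w v j) := by
      intro ρ
      unfold IsGC
      constructor
      · rintro (h | ⟨_, h⟩)
        · exact h
        · exact absurd (h i hi') hi
      · exact Or.inl
    simp only [this]
    rw [one_mul]
    exact_mod_cast k0
  · have huniq : ∀ i : Fin (w + 1), kmerAt σ k w v i = kmerAt σ k w v (Fin.last w) →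
        i = Fin.last w := by
      intro i hi
      by_contra hc
      exact h ⟨i, hc, hi⟩
    have hcard : Nat.card {ρ : (Fin k → Fin σ) ≃ Fin (σ ^ k) // IsGC σ k w ρ v} =
      Nat.card {ρ : (Fin k → Fin σ) ≃ Fin (σ ^ k) //
        ∀ j, ρ (kmerAt σ k w v 0) ≤ ρ (kmerAt σ k w v j)} +
      Nat.card {ρ : (Fin k → Fin σ) ≃ Fin (σ ^ k) //
        ∀ j, ρ (kmerAt σ k w v (Fin.last w)) ≤ ρ (kmerAt σ k w v j)} := by
      simp only [Nat.card_eq_fintype_card, Fintype.card_subtype]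
      rw [← Finset.card_union_of_disjoint]
      · congr 1
        ext ρ
        simp only [mem_filter, mem_univ, true_and, mem_union]
        unfold IsGC
        constructor
        · rintro (h | h)
          · exact Or.inl h
          · exact Or.inr h.1
        · rintro (h | h)
          · exact Or.inl h
          · exact Or.inr ⟨h, huniq⟩
      · rw [Finset.disjoint_left]
        intro ρ h1 h2
        simp only [mem_filter, mem_univ, true_and] at h1 h2
        have := huniq 0 (ρ.injective (le_antisymm (h1 _) (h2 _)))
        have := congrArg Fin.val this
        simp at this
        omega
    rw [hcard]
    push_cast
    have a0 : (_ : ℝ) = _ := congrArg (Nat.cast) k0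
    have al : (_ : ℝ) = _ := congrArg (Nat.cast) kl
    push_cast at a0 al
    linarith
end MinProb
section Ext
variable {σ k w : ℕ}

/-- Repetitive strings. -/
def RepP (σ k w : ℕ) (v : Fin (w + k) → Fin σ) : Prop :=
  ∃ i j : Fin (w + 1), i ≠ j ∧ kmerAt σ k w v i = kmerAt σ k w v j

/-- nat-valued access -/
def gv {n : ℕ} (v : Fin n → Fin σ) (x : ℕ) : ℕ := if h : x < n then (v ⟨x, h⟩).1 else 0

lemma kmer_eq_iff (v : Fin (w + k) → Fin σ) (i j : Fin (w + 1)) :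
    kmerAt σ k w v i = kmerAt σ k w v j ↔ ∀ t < k, gv v (i.1 + t) = gv v (j.1 + t) := by
  rw [funext_iff]
  constructor
  · intro h t ht
    have := h ⟨t, ht⟩
    have hi := i.2
    have hj := j.2
    simp only [kmerAt] at this
    rw [gv, gv, dif_pos (by omega), dif_pos (by omega), this]
  · intro h t
    have := h t.1 t.2
    have hi := i.2
    have hj := j.2
    have ht := t.2
    rw [gv, gv, dif_pos (by omega), dif_pos (by omega)] at this
    exact Fin.ext this

lemma sufRep_iff (v : Fin (w + k) → Fin σ) :
    SufRep σ k w v ↔ ∃ i < w, ∀ t < k, gv v (i + t) = gv v (w + t) := by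
  unfold SufRep
  constructor
  · rintro ⟨i, hi, h⟩
    rw [kmer_eq_iff] at h
    refine ⟨i.1, ?_, h⟩
    have := i.2
    have : i.1 ≠ w := fun h => hi (Fin.ext (by simpa using h))
    omega
  · rintro ⟨i, hi, h⟩
    refine ⟨⟨i, by omega⟩, ?_, ?_⟩
    · intro h; have := congrArg Fin.val h; simp at this; omega
    · rw [kmer_eq_iff]; exact h

lemma repP_iff (v : Fin (w + k) → Fin σ) :
    RepP σ k w v ↔ ∃ i p, 0 < p ∧ i + p ≤ w ∧ ∀ t < k, gv v (i + t) = gv v (i + p + t) := by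
  unfold RepP
  constructor
  · rintro ⟨i, j, hij, h⟩
    rw [kmer_eq_iff] at h
    have h1 := i.2
    have h2 := j.2
    have h3 : i.1 ≠ j.1 := fun h => hij (Fin.ext h)
    rcases lt_or_gt_of_ne h3 with h4 | h4
    · refine ⟨i.1, j.1 - i.1, by omega, by omega, ?_⟩
      rw [show i.1 + (j.1 - i.1) = j.1 by omega]; exact h
    · refine ⟨j.1, i.1 - j.1, by omega, by omega, ?_⟩
      rw [show j.1 + (i.1 - j.1) = i.1 by omega]
      exact fun t ht => (h t ht).symm
  · rintro ⟨i, p, hp, hi, h⟩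
    refine ⟨⟨i, by omega⟩, ⟨i + p, by omega⟩, ?_, ?_⟩
    · intro h; have := congrArg Fin.val h; simp at this; omega
    · rw [kmer_eq_iff]; exact h

lemma SufRep.repP {v : Fin (w + k) → Fin σ} (h : SufRep σ k w v) : RepP σ k w v := by
  obtain ⟨i, hi, h⟩ := h
  exact ⟨i, _, hi, h⟩

/-- append a letter -/
def snc (u : Fin (w + k) → Fin σ) (a : Fin σ) : Fin (w + 1 + k) → Fin σ :=
  fun x => if h : x.1 < w + k then u ⟨x.1, h⟩ else a

lemma gv_snc_lt (u : Fin (w + k) → Fin σ) (a : Fin σ) {x : ℕ} (h : x < w + k) :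
    gv (snc u a) x = gv u x := by
  rw [gv, gv, dif_pos h, dif_pos (by omega)]
  simp [snc, h]

lemma gv_snc_last (u : Fin (w + k) → Fin σ) (a : Fin σ) :
    gv (snc u a) (w + k) = a.1 := by
  rw [gv, dif_pos (by omega)]
  simp [snc]

/-- append equivalence -/
def sncE (σ k w : ℕ) : (Fin (w + k) → Fin σ) × Fin σ ≃ (Fin (w + 1 + k) → Fin σ) where
  toFun p := snc p.1 p.2
  invFun v := (fun x => v ⟨x.1, by have := x.2; omega⟩, v ⟨w + k, by omega⟩)
  left_inv := by
    rintro ⟨u, a⟩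
    simp [snc]
  right_inv := by
    intro v
    funext x
    simp only [snc]
    split_ifs with h
    · rfl
    · congr 1
      have := x.2
      apply Fin.ext
      simp
      omega

lemma sum_snc (f : (Fin (w + 1 + k) → Fin σ) → ℝ) :
    ∑ v, f v = ∑ u : Fin (w + k) → Fin σ, ∑ a : Fin σ, f (snc u a) := by
  rw [← Equiv.sum_comp (sncE σ k w), Fintype.sum_prod_type]
  rfl

lemma kmer_snc (u : Fin (w + k) → Fin σ) (a : Fin σ) (i : Fin (w + 1)) :
    kmerAt σ k (w + 1) (snc u a) i.castSucc = kmerAt σ k w u i := by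
  funext j
  have h1 := i.2
  have h2 := j.2
  simp only [kmerAt, snc, Fin.val_castSucc]
  rw [dif_pos (by omega)]

lemma image_snc (u : Fin (w + k) → Fin σ) (a : Fin σ) :
    (Finset.univ.image (kmerAt σ k (w + 1) (snc u a))) =
      insert (kmerAt σ k (w + 1) (snc u a) (Fin.last (w + 1)))
        (Finset.univ.image (kmerAt σ k w u)) := by
  ext x
  simp only [mem_image, mem_univ, true_and, mem_insert]
  rw [Fin.exists_fin_succ']
  simp only [kmer_snc]
  tauto

lemma sufRep_snc (u : Fin (w + k) → Fin σ) (a : Fin σ) :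
    SufRep σ k (w + 1) (snc u a) ↔
      kmerAt σ k (w + 1) (snc u a) (Fin.last (w + 1)) ∈ (Finset.univ.image (kmerAt σ k w u)) := by
  unfold SufRep
  rw [Fin.exists_fin_succ']
  simp [kmer_snc, Fin.castSucc_ne_last]

open Classical in
lemma num_snc (u : Fin (w + k) → Fin σ) (a : Fin σ) :
    numKmers σ k (w + 1) (snc u a) =
      if SufRep σ k (w + 1) (snc u a) then numKmers σ k w u else numKmers σ k w u + 1 := by
  unfold numKmers
  rw [image_snc]
  split_ifs with h
  · rw [Finset.insert_eq_of_mem ((sufRep_snc u a).1 h)]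
  · rw [Finset.card_insert_of_notMem (fun hc => h ((sufRep_snc u a).2 hc))]

lemma num_of_not_rep (u : Fin (w + k) → Fin σ) (h : ¬ RepP σ k w u) :
    numKmers σ k w u = w + 1 := by
  unfold numKmers
  rw [Finset.card_image_of_injective]
  · simp
  · intro i j hij
    by_contra hc
    exact h ⟨i, j, hc, hij⟩

lemma repP_snc (u : Fin (w + k) → Fin σ) (a : Fin σ) :
    RepP σ k (w + 1) (snc u a) ↔ RepP σ k w u ∨ SufRep σ k (w + 1) (snc u a) := by
  constructor
  · intro h
    by_cases hs : SufRep σ k (w + 1) (snc u a)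
    · exact Or.inr hs
    left
    obtain ⟨i, j, hij, h⟩ := h
    induction i using Fin.lastCases with
    | last => exact absurd ⟨j, hij.symm, h.symm⟩ hs
    | cast i =>
      induction j using Fin.lastCases with
      | last => exact absurd ⟨_, hij, h⟩ hs
      | cast j =>
        rw [kmer_snc, kmer_snc] at h
        exact ⟨i, j, fun hc => hij (by rw [hc]), h⟩
  · rintro (⟨i, j, hij, h⟩ | h)
    · refine ⟨i.castSucc, j.castSucc, fun hc => hij (Fin.castSucc_injective _ hc), ?_⟩
      rw [kmer_snc, kmer_snc, h]
    · exact h.repP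

/-- The key extension lemma. -/
lemma key_ext (hk : w + 1 ≤ k) (g : ℕ → ℕ) (i p q : ℕ) (hp : 0 < p) (hi : i + p ≤ w)
    (h : ∀ t < k, g (i + t) = g (i + p + t)) (hq : q < w + 1)
    (h' : ∀ t < k, g (q + t) = g (w + 1 + t)) :
    ∀ x, i ≤ x → x + p < w + 1 + k → g x = g (x + p) := by
  intro x
  induction x using Nat.strong_induction_on with
  | _ x ih =>
    intro hx hxp
    by_cases hlt : x < i + k
    · have := h (x - i) (by omega)
      rw [show i + (x - i) = x by omega, show i + p + (x - i) = x + p by omega] at this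
      exact this
    · -- g (x+p) = g (x + p - Q), Q = w + 1 - q
      have e1 := h' (x + p - (w + 1)) (by omega)
      have e2 := h' (x - (w + 1)) (by omega)
      have e3 := ih (q + (x - (w + 1))) (by omega) (by omega) (by omega)
      rw [show w + 1 + (x + p - (w + 1)) = x + p by omega] at e1
      rw [show w + 1 + (x - (w + 1)) = x by omega] at e2
      rw [show q + (x - (w + 1)) + p = q + (x + p - (w + 1)) by omega] at e3
      rw [← e1, ← e2, e3]

lemma key_snc (hk : w + 1 ≤ k) (u : Fin (w + k) → Fin σ) (a : Fin σ) (i p : ℕ)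
    (hp : 0 < p) (hi : i + p ≤ w)
    (h : ∀ t < k, gv u (i + t) = gv u (i + p + t)) (hs : SufRep σ k (w + 1) (snc u a)) :
    ∀ x, i ≤ x → x + p < w + 1 + k → gv (snc u a) x = gv (snc u a) (x + p) := by
  rw [sufRep_iff] at hs
  obtain ⟨q, hq, hs⟩ := hs
  refine key_ext hk _ i p q hp hi ?_ hq hs
  intro t ht
  rw [gv_snc_lt _ _ (by omega), gv_snc_lt _ _ (by omega)]
  exact h t ht

lemma sufRep_of_snc (hk : w + 1 ≤ k) (u : Fin (w + k) → Fin σ) (a : Fin σ)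
    (hu : RepP σ k w u) (hs : SufRep σ k (w + 1) (snc u a)) : SufRep σ k w u := by
  rw [repP_iff] at hu
  obtain ⟨i, p, hp, hi, h⟩ := hu
  have key := key_snc hk u a i p hp hi h hs
  rw [sufRep_iff]
  refine ⟨w - p, by omega, ?_⟩
  intro t ht
  have := key (w - p + t) (by omega) (by omega)
  rw [gv_snc_lt _ _ (by omega), gv_snc_lt _ _ (by omega)] at this
  rw [this]; congr 1; omega

lemma exists_unique_snc (hk : w + 1 ≤ k) (u : Fin (w + k) → Fin σ)
    (hu : SufRep σ k w u) : ∃ b, ∀ a, SufRep σ k (w + 1) (snc u a) ↔ a = b := by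
  have hr := hu.repP
  rw [sufRep_iff] at hu
  obtain ⟨i, hi, h⟩ := hu
  refine ⟨u ⟨i + k, by omega⟩, ?_⟩
  have hb : ∀ a, gv (snc u a) (i + k) = (u ⟨i + k, by omega⟩).1 := by
    intro a
    rw [gv_snc_lt _ _ (by omega), gv, dif_pos (by omega)]
  intro a
  constructor
  · intro hs
    have key := key_snc hk u a i (w - i) (by omega) (by omega)
      (by rw [show i + (w - i) = w by omega]; exact h) hs (i + k) (by omega) (by omega)
    rw [show i + k + (w - i) = w + k by omega, gv_snc_last, hb] at key
    exact (Fin.ext key).symm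
  · intro ha
    rw [sufRep_iff]
    refine ⟨i + 1, by omega, ?_⟩
    intro t ht
    by_cases htk : t + 1 < k
    · rw [gv_snc_lt _ _ (by omega), gv_snc_lt _ _ (by omega)]
      have := h (t + 1) htk
      rw [show i + 1 + t = i + (t + 1) by omega, show w + 1 + t = w + (t + 1) by omega, this]
    · rw [show i + 1 + t = i + k by omega, show w + 1 + t = w + k by omega, gv_snc_last, hb, ha]

open Classical in
/-- sum over suffix-repeated -/
noncomputable def XX (σ k w : ℕ) (f : ℕ → ℝ) : ℝ :=
  ∑ v : Fin (w + k) → Fin σ, if SufRep σ k w v then f (numKmers σ k w v) else 0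

open Classical in
/-- sum over repetitive, not suffix-repeated -/
noncomputable def YY (σ k w : ℕ) (f : ℕ → ℝ) : ℝ :=
  ∑ v : Fin (w + k) → Fin σ,
    if RepP σ k w v ∧ ¬ SufRep σ k w v then f (numKmers σ k w v) else 0

lemma XX_succ (hk : w + 1 ≤ k) : ∃ B : ℝ, ∀ f : ℕ → ℝ,
    XX σ k (w + 1) f = XX σ k w f + B * f (w + 1) := by
  classical
  refine ⟨∑ u : Fin (w + k) → Fin σ, if RepP σ k w u then 0 else
    ∑ a : Fin σ, if SufRep σ k (w + 1) (snc u a) then 1 else 0, ?_⟩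
  intro f
  unfold XX
  rw [sum_snc, Finset.sum_mul, ← Finset.sum_add_distrib]
  refine Finset.sum_congr rfl fun u _ => ?_
  by_cases hr : RepP σ k w u
  · by_cases hs : SufRep σ k w u
    · obtain ⟨b, hb⟩ := exists_unique_snc hk u hs
      simp only [num_snc, hb, hr, hs, if_true, zero_mul, add_zero]
      rw [Finset.sum_eq_single b]
      · simp
      · intro a _ ha; simp [ha]
      · simp
    · have : ∀ a, ¬ SufRep σ k (w + 1) (snc u a) :=
        fun a h => hs (sufRep_of_snc hk u a hr h)
      simp [this, hr, hs]
  · have hs : ¬ SufRep σ k w u := fun h => hr h.repP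
    simp only [num_snc, hr, hs, if_false, zero_add, num_of_not_rep u hr, Finset.sum_mul]
    refine Finset.sum_congr rfl fun a _ => ?_
    split_ifs <;> simp

lemma YY_succ (hk : w + 1 ≤ k) (f : ℕ → ℝ) :
    YY σ k (w + 1) f =
      ((σ : ℝ) - 1) * XX σ k w (fun d => f (d + 1)) + σ * YY σ k w (fun d => f (d + 1)) := by
  classical
  unfold XX YY
  rw [sum_snc, Finset.mul_sum, Finset.mul_sum, ← Finset.sum_add_distrib]
  refine Finset.sum_congr rfl fun u _ => ?_
  simp only [repP_snc, num_snc]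
  by_cases hr : RepP σ k w u
  · by_cases hs : SufRep σ k w u
    · obtain ⟨b, hb⟩ := exists_unique_snc hk u hs
      simp only [hb, hr, hs, true_or, true_and]
      have : ∀ a : Fin σ, (if ¬ a = b then f (if a = b then numKmers σ k w u else
        numKmers σ k w u + 1) else 0) = f (numKmers σ k w u + 1) -
          (if a = b then f (numKmers σ k w u + 1) else 0) := by
        intro a; by_cases h : a = b <;> simp [h]
      simp only [this]
      rw [Finset.sum_sub_distrib]
      simp
      ring
    · have : ∀ a, ¬ SufRep σ k (w + 1) (snc u a) :=
        fun a h => hs (sufRep_of_snc hk u a hr h)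
      simp [this, hr, hs]
  · have hs : ¬ SufRep σ k w u := fun h => hr h.repP
    simp [hr, hs]

lemma XX_zero (f : ℕ → ℝ) : XX σ k 0 f = 0 := by
  classical
  unfold XX
  refine Finset.sum_eq_zero fun v _ => ?_
  rw [if_neg]
  rw [sufRep_iff]
  rintro ⟨i, hi, _⟩
  omega

lemma YY_zero (f : ℕ → ℝ) : YY σ k 0 f = 0 := by
  classical
  unfold YY
  refine Finset.sum_eq_zero fun v _ => ?_
  rw [if_neg]
  rw [repP_iff]
  rintro ⟨⟨i, p, hi, _⟩, _⟩
  omega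

lemma YY_diff : ∀ w : ℕ, w + 1 ≤ k → ∃ C : ℝ, ∀ f : ℕ → ℝ,
    YY σ k (w + 1) f = YY σ k w f + C * f (w + 1) := by
  intro w
  induction w with
  | zero =>
    intro hk
    refine ⟨0, fun f => ?_⟩
    rw [YY_succ hk, XX_zero, YY_zero, YY_zero]; ring
  | succ w ih =>
    intro hk
    obtain ⟨C, hC⟩ := ih (by omega)
    obtain ⟨B, hB⟩ := XX_succ (σ := σ) (k := k) (w := w) (by omega)
    refine ⟨(σ - 1) * B + σ * C, fun f => ?_⟩
    rw [YY_succ hk, YY_succ (by omega) f, hC, hB]; ring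

/-- number of repetitive strings -/
noncomputable def RR (σ k w : ℕ) : ℝ := XX σ k w (fun _ => 1) + YY σ k w (fun _ => 1)

/-- number of suffix-repeated strings -/
noncomputable def EE (σ k w : ℕ) : ℝ := XX σ k w (fun _ => 1)

lemma EE_zero : EE σ k 0 = 0 := XX_zero _

lemma RR_zero : RR σ k 0 = 0 := by rw [RR, XX_zero, YY_zero, add_zero]

lemma RR_succ (hk : w + 1 ≤ k) :
    RR σ k (w + 1) = σ * RR σ k w + (EE σ k (w + 1) - EE σ k w) := by
  unfold RR EE
  rw [YY_succ hk]; ring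

lemma Dev_eq (hw : 1 ≤ w) : Dev σ k w =
    XX σ k w (fun d => 1 / (d : ℝ)) + YY σ k w (fun d => 2 / (d : ℝ)) -
      2 / ((w : ℝ) + 1) * RR σ k w := by
  classical
  have hmem : ∀ v, v ∈ RepSet σ k w ↔ RepP σ k w v := by
    intro v; simp [RepSet, RepP]
  have hconv : ∀ f : (Fin (w + k) → Fin σ) → ℝ, ∑ v ∈ RepSet σ k w, f v =
      ∑ v, if RepP σ k w v then f v else 0 := by
    intro f
    simp only [← hmem]
    rw [Finset.sum_ite_mem, Finset.univ_inter]
  have hcard : ((RepSet σ k w).card : ℝ) = RR σ k w := by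
    have h1 : ((RepSet σ k w).card : ℝ) = ∑ v ∈ RepSet σ k w, (1 : ℝ) := by simp
    rw [h1, hconv, RR, XX, YY, ← Finset.sum_add_distrib]
    refine Finset.sum_congr rfl fun v _ => ?_
    by_cases hs : SufRep σ k w v
    · simp [hs, hs.repP]
    · simp [hs]
  have hsum : ∑ v ∈ RepSet σ k w, Pgc σ k w v = XX σ k w (fun d => 1 / (d : ℝ)) +
      YY σ k w (fun d => 2 / (d : ℝ)) := by
    rw [hconv, XX, YY, ← Finset.sum_add_distrib]
    refine Finset.sum_congr rfl fun v _ => ?_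
    rw [Pgc_eq σ k w hw]
    by_cases hs : SufRep σ k w v
    · simp [hs, hs.repP]
    · simp [hs]
  rw [Dev, hcard, hsum]

lemma Dev_diff (hw : 1 ≤ w) (hk : w + 1 ≤ k) :
    Dev σ k (w + 1) - Dev σ k w =
      (2 * RR σ k (w + 1) - (w + 2) * (EE σ k (w + 1) - EE σ k w)) / ((w + 1) * (w + 2)) := by
  rw [Dev_eq hw, Dev_eq (by omega)]
  obtain ⟨C, hC⟩ := YY_diff (σ := σ) w hk
  obtain ⟨B, hB⟩ := XX_succ (σ := σ) (k := k) (w := w) hk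
  unfold RR EE
  simp only [hC, hB]
  push_cast
  field_simp
  ring
end Ext
section Count
variable {σ k w : ℕ}

/-- prepend a letter -/
def cns (a : Fin σ) (u : Fin (w + k) → Fin σ) : Fin (w + 1 + k) → Fin σ :=
  fun x => if h : 0 < x.1 then u ⟨x.1 - 1, by have := x.2; omega⟩ else a

lemma gv_cns (a : Fin σ) (u : Fin (w + k) → Fin σ) (x : ℕ) :
    gv (cns a u) (x + 1) = gv u x := by
  unfold gv
  by_cases h : x < w + k
  · rw [dif_pos h, dif_pos (by omega)]
    simp [cns]
  · rw [dif_neg h, dif_neg (by omega)]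

/-- prepend equivalence -/
def cnsE (σ k w : ℕ) : Fin σ × (Fin (w + k) → Fin σ) ≃ (Fin (w + 1 + k) → Fin σ) where
  toFun p := cns p.1 p.2
  invFun v := (v ⟨0, by omega⟩, fun x => v ⟨x.1 + 1, by have := x.2; omega⟩)
  left_inv := by
    rintro ⟨a, u⟩
    simp [cns]
  right_inv := by
    intro v
    funext x
    simp only [cns]
    split_ifs with h
    · congr 1
      apply Fin.ext
      simp
      omega
    · congr 1
      apply Fin.ext
      simp
      omega

lemma sum_cns (f : (Fin (w + 1 + k) → Fin σ) → ℝ) :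
    ∑ v, f v = ∑ a : Fin σ, ∑ u : Fin (w + k) → Fin σ, f (cns a u) := by
  rw [← Equiv.sum_comp (cnsE σ k w), Fintype.sum_prod_type]
  rfl

/-- whole period -/
def Z0 (k n : ℕ) (g : ℕ → ℕ) : Prop := ∀ t < k, g t = g (n + t)

/-- inner repetition -/
def ZI (k n : ℕ) (g : ℕ → ℕ) : Prop := ∃ i, 0 < i ∧ i < n ∧ ∀ t < k, g (i + t) = g (n + t)

lemma sufRep_split (v : Fin (w + 1 + k) → Fin σ) :
    SufRep σ k (w + 1) v ↔ Z0 k (w + 1) (gv v) ∨ ZI k (w + 1) (gv v) := by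
  rw [sufRep_iff]
  constructor
  · rintro ⟨i, hi, h⟩
    rcases Nat.eq_zero_or_pos i with rfl | h0
    · left; intro t ht; simpa using h t ht
    · right; exact ⟨i, h0, hi, h⟩
  · rintro (h | ⟨i, h0, hi, h⟩)
    · exact ⟨0, by omega, fun t ht => by simpa using h t ht⟩
    · exact ⟨i, hi, h⟩

lemma ZI_cns (a : Fin σ) (u : Fin (w + k) → Fin σ) :
    ZI k (w + 1) (gv (cns a u)) ↔ SufRep σ k w u := by
  rw [sufRep_iff]
  constructor
  · rintro ⟨i, h0, hi, h⟩
    refine ⟨i - 1, by omega, fun t ht => ?_⟩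
    have := h t ht
    rw [show i + t = (i - 1 + t) + 1 by omega, show w + 1 + t = w + t + 1 by omega,
      gv_cns, gv_cns] at this
    exact this
  · rintro ⟨i, hi, h⟩
    refine ⟨i + 1, by omega, by omega, fun t ht => ?_⟩
    rw [show i + 1 + t = (i + t) + 1 by omega, show w + 1 + t = w + t + 1 by omega,
      gv_cns, gv_cns]
    exact h t ht

open Classical in
lemma EE_succ : EE σ k (w + 1) = σ * EE σ k w +
    ((Finset.univ.filter fun v : Fin (w + 1 + k) → Fin σ =>
      Z0 k (w + 1) (gv v) ∧ ¬ ZI k (w + 1) (gv v)).card : ℝ) := by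
  unfold EE XX
  have h1 : ∀ v : Fin (w + 1 + k) → Fin σ,
      (if SufRep σ k (w + 1) v then (1 : ℝ) else 0) = (if ZI k (w + 1) (gv v) then 1 else 0) +
       (if Z0 k (w + 1) (gv v) ∧ ¬ ZI k (w + 1) (gv v) then 1 else 0) := by
    intro v
    rw [sufRep_split]
    by_cases ha : ZI k (w + 1) (gv v) <;> by_cases hb : Z0 k (w + 1) (gv v) <;> simp [ha, hb]
  rw [Finset.sum_congr rfl fun v _ => h1 v, Finset.sum_add_distrib]
  congr 1
  · rw [sum_cns]
    simp only [ZI_cns]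
    simp
  · simp

/-- shift -/
def shf (σ : ℕ) (x : ℕ → Fin σ) : ℕ → Fin σ := fun i => x (i + 1)

lemma shf_iter (n : ℕ) (x : ℕ → Fin σ) (i : ℕ) : ((shf σ)^[n] x) i = x (i + n) := by
  induction n generalizing i with
  | zero => rfl
  | succ n ih =>
    rw [Function.iterate_succ_apply']
    simp only [shf]
    rw [ih]; congr 1; omega

lemma shf_per (n : ℕ) (x : ℕ → Fin σ) :
    Function.IsPeriodicPt (shf σ) n x ↔ Function.Periodic x n := by
  unfold Function.IsPeriodicPt Function.IsFixedPt Function.Periodic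
  rw [funext_iff]
  simp only [shf_iter]

/-- periodic extension -/
def pex {n : ℕ} (s : Fin (n + 1) → Fin σ) : ℕ → Fin σ :=
  fun i => s ⟨i % (n + 1), Nat.mod_lt _ (by omega)⟩

open Classical in
/-- periodic points of period n+1 -/
noncomputable def PP (σ n : ℕ) : Finset (ℕ → Fin σ) :=
  Finset.univ.image (pex : (Fin (n + 1) → Fin σ) → _)

lemma card_PP (n : ℕ) : (PP σ n).card = σ ^ (n + 1) := by
  classical
  unfold PP
  rw [Finset.card_image_of_injective]
  · simp
  · intro s t h
    funext i
    have := congrFun h i.1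
    simp only [pex] at this
    have hi : i.1 % (n + 1) = i.1 := Nat.mod_eq_of_lt i.2
    simpa [hi] using this

lemma mem_PP (n : ℕ) (x : ℕ → Fin σ) : x ∈ PP σ n ↔ Function.Periodic x (n + 1) := by
  classical
  unfold PP
  simp only [mem_image, mem_univ, true_and]
  constructor
  · rintro ⟨s, rfl⟩ i
    simp [pex]
  · intro h
    refine ⟨fun i => x i.1, ?_⟩
    funext i
    simp only [pex]
    exact h.map_mod_nat i

open Classical in
/-- sequences with minimal period n -/
noncomputable def QQ (σ n : ℕ) : ℕ :=
  ((PP σ (n - 1)).filter fun x => Function.minimalPeriod (shf σ) x = n).card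

lemma sum_QQ (n : ℕ) (hn : 0 < n) : ∑ d ∈ n.divisors, QQ σ d = σ ^ n := by
  classical
  obtain ⟨m, rfl⟩ : ∃ m, n = m + 1 := ⟨n - 1, by omega⟩
  rw [← card_PP, Finset.card_eq_sum_card_fiberwise
    (f := fun x => Function.minimalPeriod (shf σ) x) (t := (m + 1).divisors)]
  · refine Finset.sum_congr rfl fun d hd => ?_
    have hd' := Nat.dvd_of_mem_divisors hd
    have hd0 := Nat.pos_of_mem_divisors hd
    unfold QQ
    congr 1
    ext x
    simp only [mem_filter, mem_PP, and_congr_left_iff]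
    rintro rfl
    have h1 : Function.minimalPeriod (shf σ) x - 1 + 1 = Function.minimalPeriod (shf σ) x := by
      omega
    rw [h1, ← shf_per, ← shf_per]
    constructor
    · intro h; exact h.trans_dvd hd'
    · intro _; exact Function.isPeriodicPt_minimalPeriod _ _
  · intro x hx
    have hx' : x ∈ PP σ m := hx
    rw [mem_PP, ← shf_per] at hx'
    have := hx'.minimalPeriod_dvd
    simpa using this

lemma per_congr {x : ℕ → Fin σ} {n : ℕ} (h : Function.Periodic x n) {a b : ℕ}
    (hab : a % n = b % n) : x a = x b := by
  rw [← h.map_mod_nat a, ← h.map_mod_nat b, hab]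

lemma gv_per {n : ℕ} (v : Fin (n + 1 + k) → Fin σ)
    (h : Z0 k (n + 1) (gv v)) : ∀ y (hy : y < n + 1 + k),
      v ⟨y, hy⟩ = v ⟨y % (n + 1), by have := Nat.mod_lt y (show 0 < n + 1 by omega); omega⟩ := by
  intro y
  induction y using Nat.strong_induction_on with
  | _ y ih =>
    intro hy
    by_cases hlt : y < n + 1
    · congr 1; apply Fin.ext; simp [Nat.mod_eq_of_lt hlt]
    · have h1 := ih (y - (n + 1)) (by omega) (by omega)
      have h2 := h (y - (n + 1)) (by omega)
      rw [gv, gv, dif_pos (by omega), dif_pos (by omega)] at h2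
      have h3 := Fin.ext h2
      have e1 : (⟨n + 1 + (y - (n + 1)), by omega⟩ : Fin (n + 1 + k)) = ⟨y, hy⟩ := by
        apply Fin.ext; simp; omega
      rw [e1] at h3
      rw [← h3, h1]
      congr 1
      apply Fin.ext
      simp only
      conv_rhs => rw [show y = (y - (n + 1)) + (n + 1) by omega, Nat.add_mod_right]

open Classical in
lemma card_Z {n : ℕ} (hk : n + 1 ≤ k) :
    (Finset.univ.filter fun v : Fin (n + 1 + k) → Fin σ =>
      Z0 k (n + 1) (gv v) ∧ ¬ ZI k (n + 1) (gv v)).card = QQ σ (n + 1) := by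
  unfold QQ
  refine Finset.card_nbij'
    (fun v x => v ⟨x % (n + 1), by have := Nat.mod_lt x (show 0 < n + 1 by omega); omega⟩)
    (fun x t => x t.1) ?_ ?_ ?_ ?_
  · intro v hv
    simp only [coe_filter, mem_univ, true_and, Set.mem_ofPred_eq] at hv
    obtain ⟨h0, hI⟩ := hv
    set x : ℕ → Fin σ := fun x => v ⟨x % (n + 1), by
      have := Nat.mod_lt x (show 0 < n + 1 by omega); omega⟩ with hx
    have hper : Function.Periodic x (n + 1) := by
      intro i; simp [hx]
    have hgv : ∀ y, y < n + 1 + k → gv v y = (x y).1 := by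
      intro y hy
      rw [gv, dif_pos hy, gv_per v h0]
    have hdvd : Function.minimalPeriod (shf σ) x ∣ n + 1 :=
      ((shf_per _ _).2 hper).minimalPeriod_dvd
    have hle := Nat.le_of_dvd (by omega) hdvd
    have hpos := Nat.pos_of_dvd_of_pos hdvd (by omega)
    simp only [coe_filter, Set.mem_ofPred_eq, mem_PP, Nat.add_sub_cancel]
    suffices hmp : Function.minimalPeriod (shf σ) x = n + 1 from ⟨hper, hmp⟩
    by_contra hne
    apply hI
    refine ⟨n + 1 - Function.minimalPeriod (shf σ) x, by omega, by omega, fun t ht => ?_⟩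
    rw [hgv _ (by omega), hgv _ (by omega)]
    have hm := (shf_per _ _).1 (Function.isPeriodicPt_minimalPeriod (shf σ) x)
    have := hm (n + 1 - Function.minimalPeriod (shf σ) x + t)
    rw [← this]
    congr 2; omega
  · intro x hx
    simp only [coe_filter, Set.mem_ofPred_eq, mem_PP, Nat.add_sub_cancel] at hx
    obtain ⟨hper, hmin⟩ := hx
    simp only [coe_filter, mem_univ, true_and, Set.mem_ofPred_eq]
    have hgv : ∀ y, y < n + 1 + k → gv (fun t : Fin (n + 1 + k) => x t.1) y = (x y).1 := by
      intro y hy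
      rw [gv, dif_pos hy]
    constructor
    · intro t ht
      rw [hgv _ (by omega), hgv _ (by omega), per_congr hper]
      simp
    · rintro ⟨i, hi0, hi, h⟩
      have hp : Function.Periodic x (n + 1 - i) := by
        intro j
        set t := (j + (n + 1 - i)) % (n + 1) with ht
        have htl : t < n + 1 := Nat.mod_lt _ (by omega)
        have := h t (by omega)
        rw [hgv _ (by omega), hgv _ (by omega)] at this
        have e := Fin.ext this
        have e1 : x (j + (n + 1 - i)) = x (n + 1 + t) := per_congr hper (by simp [ht])
        have e2 : x (i + t) = x j := by
          apply per_congr hper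
          rw [ht, Nat.add_mod_mod, show i + (j + (n + 1 - i)) = j + (n + 1) by omega,
            Nat.add_mod_right]
        rw [e1, ← e, e2]
      have := ((shf_per _ _).2 hp).minimalPeriod_dvd
      rw [hmin] at this
      have := Nat.le_of_dvd (by omega) this
      omega
  · intro v hv
    simp only [coe_filter, mem_univ, true_and, Set.mem_ofPred_eq] at hv
    funext t
    exact (gv_per v hv.1 t.1 t.2).symm
  · intro x hx
    simp only [coe_filter, Set.mem_ofPred_eq, mem_PP, Nat.add_sub_cancel] at hx
    funext t
    exact hx.1.map_mod_nat t

lemma EE_succ' (hk : w + 1 ≤ k) : EE σ k (w + 1) = σ * EE σ k w + (QQ σ (w + 1) : ℝ) := by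
  classical
  rw [EE_succ, ← card_Z hk]
end Count

lemma QQ_vals (σ : ℕ) : ((QQ σ 1 : ℝ) = σ ∧ (QQ σ 2 : ℝ) = σ ^ 2 - σ ∧ (QQ σ 3 : ℝ) = σ ^ 3 - σ ∧
    (QQ σ 4 : ℝ) = σ ^ 4 - σ ^ 2 ∧ (QQ σ 5 : ℝ) = σ ^ 5 - σ ∧
    (QQ σ 6 : ℝ) = σ ^ 6 - σ ^ 3 - σ ^ 2 + σ ∧ (QQ σ 7 : ℝ) = σ ^ 7 - σ ∧
    (QQ σ 8 : ℝ) = σ ^ 8 - σ ^ 4 ∧ (QQ σ 9 : ℝ) = σ ^ 9 - σ ^ 3 ∧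
    (QQ σ 10 : ℝ) = σ ^ 10 - σ ^ 5 - σ ^ 2 + σ ∧ (QQ σ 11 : ℝ) = σ ^ 11 - σ) := by
  have h : ∀ n, 0 < n → ∑ d ∈ n.divisors, (QQ σ d : ℝ) = (σ : ℝ) ^ n := by
    intro n hn
    exact_mod_cast sum_QQ n hn
  have h1 := h 1 (by norm_num)
  have h2 := h 2 (by norm_num)
  have h3 := h 3 (by norm_num)
  have h4 := h 4 (by norm_num)
  have h5 := h 5 (by norm_num)
  have h6 := h 6 (by norm_num)
  have h7 := h 7 (by norm_num)
  have h8 := h 8 (by norm_num)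
  have h9 := h 9 (by norm_num)
  have h10 := h 10 (by norm_num)
  have h11 := h 11 (by norm_num)
  rw [show Nat.divisors 1 = {1} by rfl] at h1
  rw [show Nat.divisors 2 = {1, 2} by rfl] at h2
  rw [show Nat.divisors 3 = {1, 3} by rfl] at h3
  rw [show Nat.divisors 4 = {1, 2, 4} by rfl] at h4
  rw [show Nat.divisors 5 = {1, 5} by rfl] at h5
  rw [show Nat.divisors 6 = {1, 2, 3, 6} by rfl] at h6
  rw [show Nat.divisors 7 = {1, 7} by rfl] at h7
  rw [show Nat.divisors 8 = {1, 2, 4, 8} by rfl] at h8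
  rw [show Nat.divisors 9 = {1, 3, 9} by rfl] at h9
  rw [show Nat.divisors 10 = {1, 2, 5, 10} by rfl] at h10
  rw [show Nat.divisors 11 = {1, 11} by rfl] at h11
  simp at h1 h2 h3 h4 h5 h6 h7 h8 h9 h10 h11
  have h1' : (QQ σ 1 : ℝ) = σ := by exact_mod_cast h1
  refine ⟨?_, ?_, ?_, ?_, ?_, ?_, ?_, ?_, ?_, ?_, ?_⟩ <;> linarith

/-- recursion for the number of suffix-repeated strings -/
noncomputable def eS (σ : ℕ) : ℕ → ℝ
  | 0 => 0
  | n + 1 => σ * eS σ n + (QQ σ (n + 1) : ℝ)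

/-- recursion for the number of repetitive strings -/
noncomputable def rS (σ : ℕ) : ℕ → ℝ
  | 0 => 0
  | n + 1 => σ * rS σ n + (eS σ (n + 1) - eS σ n)

lemma EE_eq_eS (σ k : ℕ) : ∀ n, n ≤ k → EE σ k n = eS σ n := by
  intro n
  induction n with
  | zero => intro _; rw [EE_zero, eS]
  | succ n ih => intro h; rw [EE_succ' h, eS, ih (by omega)]

lemma RR_eq_rS (σ k : ℕ) : ∀ n, n ≤ k → RR σ k n = rS σ n := by
  intro n
  induction n with
  | zero => intro _; rw [RR_zero, rS]
  | succ n ih =>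
    intro h
    rw [RR_succ h, rS, ih (by omega), EE_eq_eS σ k _ h, EE_eq_eS σ k n (by omega)]

theorem stmt15 (σ k w : ℕ) (hσ : 2 ≤ σ) (hw1 : 1 ≤ w) (hw10 : w ≤ 10) (hwk : w + 1 ≤ k) :
    0 < Dev σ k (w + 1) - Dev σ k w := by
  rw [Dev_diff hw1 hwk]
  apply div_pos _ (by positivity)
  rw [RR_eq_rS σ k _ hwk, EE_eq_eS σ k _ hwk, EE_eq_eS σ k w (by omega)]
  obtain ⟨q1, q2, q3, q4, q5, q6, q7, q8, q9, q10, q11⟩ := QQ_vals σ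
  clear hwk
  obtain ⟨s, rfl⟩ : ∃ s, σ = s + 2 := ⟨σ - 2, by omega⟩
  interval_cases w <;>
  · simp only [rS, eS, Nat.reduceAdd, q1, q2, q3, q4, q5, q6, q7, q8, q9, q10, q11]
    push_cast
    ring_nf
    positivity
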